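/- Let X be a measurable space, S ⊆ X a measurable set, and let p_r, p_c, p'_r, p'_c be probability measures on X with p_r(X∖S) = p'_r(X∖S) = 0 and p_c(S) = p'_c(S) = 0. Let α ∈ (0,1), β ∈ (0,1), and p = α·p_r + (1−α)·p_c. Let d be a function assigning to each pair of probability measures on X a value in [0,∞] such that d(μ, ν) = 0 if and only if μ = ν. Assume p_r ≪ p'_r and p_c ≪ p'_c. Let F be the set of pairs (q_r, q_c) of probability measures on X with q_r ≪ p'_r + p'_c and q_c ≪ p'_r + p'_c, and for (q_r, q_c) ∈ F define J(q_r, q_c) = d(α·q_r + (1−α)·q_c, p) + I(q_r, q_c), where I(q_r, q_c) is the infimum over measurable C : X → [0,1] of β·∫(−log C) dp'_r + (1−β)·∫(−log(1−C)) dp'_c + α·∫(−log C) dq_r + (1−α)·∫(−log(1−C)) dq_c. Then the pair (p_r, p_c) belongs to F and attains the infimum of J over F (which equals 0), and every (q*_r, q*_c) ∈ F attaining this infimum satisfies d(q*_r, p_r) = 0, i.e., q*_r = p_r. -/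

import Mathlib

open MeasureTheory Filter Topology
open scoped ENNReal Classical

/-- The negative logarithm on `[0, 1]`, with value `⊤` at `0`. -/
noncomputable def negLog (t : ℝ) : ℝ≥0∞ := if t = 0 then ⊤ else ENNReal.ofReal (-Real.log t)

lemma measurable_negLog : Measurable negLog :=
  Measurable.ite (measurableSet_singleton 0) measurable_const
    Real.measurable_log.neg.ennreal_ofReal

@[simp] lemma negLog_one : negLog 1 = 0 := by simp [negLog]

lemma ofReal_log_two_le_negLog {t : ℝ} (h0 : 0 ≤ t) (ht : t ≤ 1 / 2) :
    ENNReal.ofReal (Real.log 2) ≤ negLog t := by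
  unfold negLog
  split_ifs with h
  · exact le_top
  · have hlog := Real.log_le_log (lt_of_le_of_ne h0 (Ne.symm h)) ht
    rw [one_div, Real.log_inv] at hlog
    exact ENNReal.ofReal_le_ofReal (by linarith)

lemma not_tendsto_negLog_and_negLog_one_sub {c : ℕ → ℝ} (hc : ∀ n, c n ∈ Set.Icc (0 : ℝ) 1)
    (h : Tendsto (fun n => negLog (c n)) atTop (𝓝 0))
    (h' : Tendsto (fun n => negLog (1 - c n)) atTop (𝓝 0)) : False := by
  have hpos : 0 < ENNReal.ofReal (Real.log 2) :=
    ENNReal.ofReal_pos.2 (Real.log_pos one_lt_two)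
  obtain ⟨n, hn, hn'⟩ := ((h.eventually_lt_const hpos).and (h'.eventually_lt_const hpos)).exists
  rcases le_total (c n) (1 / 2) with hle | hle
  · exact hn.not_ge (ofReal_log_two_le_negLog (hc n).1 hle)
  · exact hn'.not_ge (ofReal_log_two_le_negLog (by linarith [(hc n).2]) (by linarith))

lemma ae_tendsto_zero_of_mul_lintegral_le {X : Type*} [MeasurableSpace X] {μ : Measure X}
    {f : ℕ → X → ℝ≥0∞} (hf : ∀ n, Measurable (f n)) {w : ℝ≥0∞} (hw : w ≠ 0)
    {ε : ℕ → ℝ≥0∞} (hε : ∑' n, ε n ≠ ⊤) (h : ∀ n, w * ∫⁻ x, f n x ∂μ ≤ ε n) :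
    ∀ᵐ x ∂μ, Tendsto (fun n => f n x) atTop (𝓝 0) := by
  have hsum : w * ∑' n, ∫⁻ x, f n x ∂μ ≠ ⊤ := by
    rw [← ENNReal.tsum_mul_left]
    exact ne_top_of_le_ne_top hε (ENNReal.tsum_le_tsum h)
  have hint : ∫⁻ x, ∑' n, f n x ∂μ ≠ ⊤ := by
    rw [lintegral_tsum fun n => (hf n).aemeasurable]
    exact fun htop => hsum (by rw [htop, ENNReal.mul_top hw])
  filter_upwards [ae_lt_top (Measurable.tsum hf) hint] with x hx
  exact ENNReal.tendsto_atTop_zero_of_tsum_ne_top hx.ne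

/-- The weighted cross-entropy loss of a classifier `C` on the labeled distributions `p'r`, `p'c`
and the generated distributions `qr`, `qc`. -/
noncomputable def classificationLoss {X : Type*} [MeasurableSpace X] (α β : ℝ)
    (p'r p'c qr qc : Measure X) (C : X → ℝ) : ℝ≥0∞ :=
  ENNReal.ofReal β * ∫⁻ x, negLog (C x) ∂p'r +
    ENNReal.ofReal (1 - β) * ∫⁻ x, negLog (1 - C x) ∂p'c +
    ENNReal.ofReal α * ∫⁻ x, negLog (C x) ∂qr +
    ENNReal.ofReal (1 - α) * ∫⁻ x, negLog (1 - C x) ∂qc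

lemma classificationLoss_indicator_eq_zero {X : Type*} [MeasurableSpace X] {S : Set X}
    (α β : ℝ) {p'r p'c qr qc : Measure X} (hp'r : p'r Sᶜ = 0) (hp'c : p'c S = 0)
    (hqr : qr Sᶜ = 0) (hqc : qc S = 0) :
    classificationLoss α β p'r p'c qr qc (S.indicator 1) = 0 := by
  have hrare : ∀ μ : Measure X, μ Sᶜ = 0 → ∫⁻ x, negLog (S.indicator 1 x) ∂μ = 0 := by
    intro μ hμ
    refine lintegral_eq_zero_of_ae_eq_zero ?_
    filter_upwards [compl_mem_ae_iff.2 hμ] with x hx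
    rw [compl_compl] at hx
    simp [hx]
  have hcommon : ∀ μ : Measure X, μ S = 0 → ∫⁻ x, negLog (1 - S.indicator 1 x) ∂μ = 0 := by
    intro μ hμ
    refine lintegral_eq_zero_of_ae_eq_zero ?_
    filter_upwards [compl_mem_ae_iff.2 hμ] with x hx
    simp [Set.indicator_of_notMem hx]
  simp [classificationLoss, hrare _ hp'r, hrare _ hqr, hcommon _ hp'c, hcommon _ hqc]

/-- If the classification loss can be made arbitrarily small, the generated conditionals are
concentrated on the regions of their classes. -/
lemma concentrated_of_iInf_classificationLoss_eq_zero {X : Type*} [MeasurableSpace X] {S : Set X}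
    {α β : ℝ} (hα : α ∈ Set.Ioo (0 : ℝ) 1) (hβ : β ∈ Set.Ioo (0 : ℝ) 1)
    {p'r p'c qr qc : Measure X} (hp'r : p'r Sᶜ = 0) (hp'c : p'c S = 0)
    (hqr : qr ≪ p'r + p'c) (hqc : qc ≪ p'r + p'c)
    (h : ⨅ (C : X → ℝ) (_ : Measurable C ∧ ∀ x, C x ∈ Set.Icc (0 : ℝ) 1),
      classificationLoss α β p'r p'c qr qc C = 0) :
    qr Sᶜ = 0 ∧ qc S = 0 := by
  obtain ⟨ε, hε, hεsum⟩ := ENNReal.exists_pos_sum_of_countable' one_ne_zero ℕ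
  have hεtop : ∑' n, ε n ≠ ⊤ := hεsum.ne_top
  have hex : ∀ n, ∃ C : X → ℝ, (Measurable C ∧ ∀ x, C x ∈ Set.Icc (0 : ℝ) 1) ∧
      classificationLoss α β p'r p'c qr qc C < ε n := by
    intro n
    have hn := hε n
    rw [← h] at hn
    simpa only [iInf_lt_iff, exists_prop] using hn
  choose C hC hCε using hex
  have hf : ∀ n, Measurable fun x => negLog (C n x) := fun n =>
    measurable_negLog.comp (hC n).1
  have hg : ∀ n, Measurable fun x => negLog (1 - C n x) := fun n =>
    measurable_negLog.comp (measurable_const.sub (hC n).1)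
  have hw : ∀ {t : ℝ}, 0 < t → ENNReal.ofReal t ≠ 0 := fun ht => (ENNReal.ofReal_pos.2 ht).ne'
  have hfp' := ae_tendsto_zero_of_mul_lintegral_le (μ := p'r) hf (hw hβ.1) hεtop fun n =>
    ((le_self_add.trans le_self_add).trans le_self_add).trans (hCε n).le
  have hgp' := ae_tendsto_zero_of_mul_lintegral_le (μ := p'c) hg (hw (sub_pos.2 hβ.2)) hεtop
    fun n => ((le_add_self.trans le_self_add).trans le_self_add).trans (hCε n).le
  have hfq := ae_tendsto_zero_of_mul_lintegral_le (μ := qr) hf (hw hα.1) hεtop fun n =>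
    (le_add_self.trans le_self_add).trans (hCε n).le
  have hgq := ae_tendsto_zero_of_mul_lintegral_le (μ := qc) hg (hw (sub_pos.2 hα.2)) hεtop
    fun n => le_add_self.trans (hCε n).le
  have hrare : ∀ᵐ x ∂(p'r + p'c), x ∈ S → Tendsto (fun n => negLog (C n x)) atTop (𝓝 0) := by
    refine ae_add_measure_iff.2 ⟨hfp'.mono fun x hx _ => hx, ?_⟩
    filter_upwards [compl_mem_ae_iff.2 hp'c] with x hx hxS using absurd hxS hx
  have hcommon : ∀ᵐ x ∂(p'r + p'c),
      x ∈ Sᶜ → Tendsto (fun n => negLog (1 - C n x)) atTop (𝓝 0) := by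
    refine ae_add_measure_iff.2 ⟨?_, hgp'.mono fun x hx _ => hx⟩
    filter_upwards [compl_mem_ae_iff.2 hp'r] with x hx hxS using absurd hxS hx
  constructor
  · rw [measure_eq_zero_iff_ae_notMem]
    filter_upwards [hqr.ae_le hcommon, hfq] with x hx hfx hxS
    exact not_tendsto_negLog_and_negLog_one_sub (fun n => (hC n).2 x) hfx (hx hxS)
  · rw [measure_eq_zero_iff_ae_notMem]
    filter_upwards [hqc.ae_le hrare, hgq] with x hx hgx hxS
    exact not_tendsto_negLog_and_negLog_one_sub (fun n => (hC n).2 x) (hx hxS) hgx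

lemma eq_of_mixture_eq_of_concentrated {X : Type*} [MeasurableSpace X] {S : Set X}
    {a b : ℝ≥0∞} (ha : a ≠ 0) (ha' : a ≠ ⊤) {μ μ' ν ν' : Measure X}
    (hμ : μ Sᶜ = 0) (hμ' : μ' Sᶜ = 0) (hν : ν S = 0) (hν' : ν' S = 0)
    (h : a • μ + b • ν = a • μ' + b • ν') : μ = μ' := by
  ext A -
  have hA := congrArg (fun m : Measure X => m (A ∩ S)) h
  simp only [Measure.add_apply, Measure.smul_apply, smul_eq_mul,
    measure_mono_null Set.inter_subset_right hν, measure_mono_null Set.inter_subset_right hν',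
    mul_zero, add_zero, measure_inter_conull hμ, measure_inter_conull hμ'] at hA
  exact (ENNReal.mul_right_inj ha ha').1 hA

lemma isProbabilityMeasure_mixture {X : Type*} [MeasurableSpace X] {α : ℝ}
    (hα : α ∈ Set.Icc (0 : ℝ) 1) (μ ν : Measure X) [IsProbabilityMeasure μ]
    [IsProbabilityMeasure ν] :
    IsProbabilityMeasure (ENNReal.ofReal α • μ + ENNReal.ofReal (1 - α) • ν) := by
  constructor
  simp [← ENNReal.ofReal_add hα.1 (sub_nonneg.2 hα.2)]

/-- Proposition 1 (minimizer form): (p_r, p_c) belongs to the feasible set F and attains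
the infimum of the generalized ACGAN objective J over F (which equals 0), and every
minimizer (q*_r, q*_c) ∈ F satisfies d(q*_r, p_r) = 0, i.e., q*_r = p_r. -/
theorem acgan_minimizer_rare_class
    {X : Type*} [MeasurableSpace X] (S : Set X) (hS : MeasurableSet S)
    (pr pc p'r p'c : Measure X)
    [IsProbabilityMeasure pr] [IsProbabilityMeasure pc]
    [IsProbabilityMeasure p'r] [IsProbabilityMeasure p'c]
    (hpr : pr Sᶜ = 0) (hp'r : p'r Sᶜ = 0) (hpc : pc S = 0) (hp'c : p'c S = 0)
    (α β : ℝ) (hα : α ∈ Set.Ioo (0:ℝ) 1) (hβ : β ∈ Set.Ioo (0:ℝ) 1)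
    (p : Measure X) (hp : p = ENNReal.ofReal α • pr + ENNReal.ofReal (1 - α) • pc)
    (d : Measure X → Measure X → ℝ≥0∞)
    (hd : ∀ μ ν : Measure X, IsProbabilityMeasure μ → IsProbabilityMeasure ν →
      (d μ ν = 0 ↔ μ = ν))
    (nl : ℝ → ℝ≥0∞) (hnl : ∀ t, nl t = if t = 0 then ⊤ else ENNReal.ofReal (-Real.log t))
    (I : Measure X → Measure X → ℝ≥0∞)
    (hI : ∀ qr qc : Measure X, I qr qc =
      ⨅ (C : X → ℝ) (_ : Measurable C ∧ ∀ x, C x ∈ Set.Icc (0:ℝ) 1),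
        ENNReal.ofReal β * ∫⁻ x, nl (C x) ∂p'r +
        ENNReal.ofReal (1 - β) * ∫⁻ x, nl (1 - C x) ∂p'c +
        ENNReal.ofReal α * ∫⁻ x, nl (C x) ∂qr +
        ENNReal.ofReal (1 - α) * ∫⁻ x, nl (1 - C x) ∂qc)
    (J : Measure X → Measure X → ℝ≥0∞)
    (hJ : ∀ qr qc : Measure X, J qr qc =
      d (ENNReal.ofReal α • qr + ENNReal.ofReal (1 - α) • qc) p + I qr qc)
    (hprac : pr ≪ p'r) (hpcac : pc ≪ p'c) :
    (pr ≪ p'r + p'c ∧ pc ≪ p'r + p'c) ∧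
    J pr pc = 0 ∧
    (⨅ (q : Measure X × Measure X)
        (_ : IsProbabilityMeasure q.1 ∧ IsProbabilityMeasure q.2 ∧
          q.1 ≪ p'r + p'c ∧ q.2 ≪ p'r + p'c), J q.1 q.2) = 0 ∧
    (∀ qr qc : Measure X, IsProbabilityMeasure qr → IsProbabilityMeasure qc →
      qr ≪ p'r + p'c → qc ≪ p'r + p'c → J qr qc = 0 → d qr pr = 0 ∧ qr = pr) := by
  obtain rfl : nl = negLog := funext hnl
  subst hp
  have hα' : α ∈ Set.Icc (0 : ℝ) 1 := Set.Ioo_subset_Icc_self hα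
  have hprF : pr ≪ p'r + p'c := hprac.trans (Measure.AbsolutelyContinuous.rfl.add_right p'c)
  have hpcF : pc ≪ p'r + p'c :=
    hpcac.trans (add_comm p'c p'r ▸ Measure.AbsolutelyContinuous.rfl.add_right p'r)
  have hp := isProbabilityMeasure_mixture hα' pr pc
  have hJ0 : J pr pc = 0 := by
    rw [hJ, (hd _ _ hp hp).2 rfl, zero_add, hI, ← nonpos_iff_eq_zero]
    refine (iInf₂_le (S.indicator 1) ⟨measurable_one.indicator hS, fun x => ?_⟩).trans
      (classificationLoss_indicator_eq_zero α β hp'r hp'c hpr hpc).le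
    by_cases hx : x ∈ S <;> simp [hx]
  refine ⟨⟨hprF, hpcF⟩, hJ0, ?_, ?_⟩
  · rw [← nonpos_iff_eq_zero]
    exact (iInf₂_le (pr, pc) ⟨inferInstance, inferInstance, hprF, hpcF⟩).trans hJ0.le
  · intro qr qc hqr hqc hqrF hqcF hq
    rw [hJ, add_eq_zero, hI] at hq
    obtain ⟨hqrS, hqcS⟩ :=
      concentrated_of_iInf_classificationLoss_eq_zero hα hβ hp'r hp'c hqrF hqcF hq.2
    have hmix := (hd _ _ (isProbabilityMeasure_mixture hα' qr qc) hp).1 hq.1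
    have heq : qr = pr := eq_of_mixture_eq_of_concentrated (ENNReal.ofReal_pos.2 hα.1).ne'
      ENNReal.ofReal_ne_top hqrS hpr hqcS hpc hmix
    exact ⟨(hd qr pr hqr inferInstance).2 heq, heq⟩
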